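/- Let C ⊆ M(n×m, F_q) be a linear rank-metric code (F_q-subspace of matrices). For a subspace V ≤ F_q^n, let C(V) be the subspace of matrices in C whose row space is contained in V, and define ρ_C(V) = m·dim(V) − dim(C(V)). Then ρ_C is bounded increasing with respect to m·dim (0 ≤ ρ_C(V2)−ρ_C(V1) ≤ m·dim(V2)−m·dim(V1) for V1 ≤ V2) and submodular (ρ_C(V1)+ρ_C(V2) ≥ ρ_C(V1+V2)+ρ_C(V1∩V2)). -/

import Mathlib

/-- The submodule of `m × n` matrices all of whose rows lie in `V`, i.e. whose
row space is contained in `V`. -/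
def rowSpaceIn {F : Type*} [Field F] {m n : ℕ}
    (V : Submodule F (Fin n → F)) : Submodule F (Matrix (Fin m) (Fin n) F) where
  carrier := {A | ∀ i, A i ∈ V}
  add_mem' := fun hA hB i => V.add_mem (hA i) (hB i)
  zero_mem' := fun _ => V.zero_mem
  smul_mem' := fun c _ hA i => V.smul_mem c (hA i)

namespace rowSpaceIn

variable {F : Type*} [Field F] {m n : ℕ}

theorem mem_iff {V : Submodule F (Fin n → F)} {A : Matrix (Fin m) (Fin n) F} :
    A ∈ rowSpaceIn V ↔ ∀ i, A i ∈ V :=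
  Iff.rfl

theorem mono {V W : Submodule F (Fin n → F)} (h : V ≤ W) :
    (rowSpaceIn V : Submodule F (Matrix (Fin m) (Fin n) F)) ≤ rowSpaceIn W :=
  fun _ hA i => h (hA i)

theorem inf_eq (V W : Submodule F (Fin n → F)) :
    (rowSpaceIn (V ⊓ W) : Submodule F (Matrix (Fin m) (Fin n) F)) =
      rowSpaceIn V ⊓ rowSpaceIn W := by
  ext A
  simp only [Submodule.mem_inf, mem_iff, forall_and]

/-- A matrix with rows in `V` is a family of elements of `V`. -/
def equivPi (V : Submodule F (Fin n → F)) :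
    (rowSpaceIn V : Submodule F (Matrix (Fin m) (Fin n) F)) ≃ₗ[F] (Fin m → V) where
  toFun A i := ⟨A.1 i, A.2 i⟩
  invFun f := ⟨fun i => (f i).1, fun i => (f i).2⟩
  map_add' _ _ := rfl
  map_smul' _ _ := rfl
  left_inv _ := rfl
  right_inv _ := rfl

theorem finrank_eq (V : Submodule F (Fin n → F)) :
    Module.finrank F (rowSpaceIn V : Submodule F (Matrix (Fin m) (Fin n) F)) =
      m * Module.finrank F V := by
  rw [(equivPi V).finrank_eq, Module.finrank_pi_fintype]
  simp

theorem finrank_inf_add_le (C : Submodule F (Matrix (Fin m) (Fin n) F))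
    {V W : Submodule F (Fin n → F)} (h : V ≤ W) :
    Module.finrank F ↥(C ⊓ rowSpaceIn W) + m * Module.finrank F V ≤
      m * Module.finrank F W + Module.finrank F ↥(C ⊓ rowSpaceIn V) := by
  have hdim := Submodule.finrank_sup_add_finrank_inf_eq (C ⊓ rowSpaceIn W) (rowSpaceIn V)
  rw [inf_assoc, inf_eq_right.mpr (mono h), finrank_eq] at hdim
  have hsup := Submodule.finrank_mono (sup_le (inf_le_right (a := C)) (mono h))
  rw [finrank_eq] at hsup
  omega

theorem finrank_inf_add_finrank_inf_le (C : Submodule F (Matrix (Fin m) (Fin n) F))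
    (V W : Submodule F (Fin n → F)) :
    Module.finrank F ↥(C ⊓ rowSpaceIn V) + Module.finrank F ↥(C ⊓ rowSpaceIn W) ≤
      Module.finrank F ↥(C ⊓ rowSpaceIn (V ⊔ W)) +
        Module.finrank F ↥(C ⊓ rowSpaceIn (V ⊓ W)) := by
  rw [← Submodule.finrank_sup_add_finrank_inf_eq, ← inf_inf_distrib_left, ← inf_eq]
  gcongr
  exact Submodule.finrank_mono <| sup_le (inf_le_inf_left C (mono le_sup_left))
    (inf_le_inf_left C (mono le_sup_right))

end rowSpaceIn

/-- For a rank-metric code `C`, the function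
`ρ_C(V) = m·dim V − dim C(V)` is bounded increasing with respect to `m·dim`
and submodular. -/
theorem rank_metric_latroid
    {F : Type*} [Field F] [Fintype F] (m n : ℕ)
    (C : Submodule F (Matrix (Fin m) (Fin n) F)) :
    (∀ V1 V2 : Submodule F (Fin n → F), V1 ≤ V2 →
      0 ≤ ((m * Module.finrank F V2 - Module.finrank F ↥(C ⊓ rowSpaceIn V2) : ℤ)
            - (m * Module.finrank F V1 - Module.finrank F ↥(C ⊓ rowSpaceIn V1) : ℤ)) ∧
      ((m * Module.finrank F V2 - Module.finrank F ↥(C ⊓ rowSpaceIn V2) : ℤ)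
            - (m * Module.finrank F V1 - Module.finrank F ↥(C ⊓ rowSpaceIn V1) : ℤ))
        ≤ (m * Module.finrank F V2 : ℤ) - (m * Module.finrank F V1 : ℤ)) ∧
    (∀ V1 V2 : Submodule F (Fin n → F),
      (m * Module.finrank F ↥(V1 ⊔ V2) - Module.finrank F ↥(C ⊓ rowSpaceIn (V1 ⊔ V2)) : ℤ)
        + (m * Module.finrank F ↥(V1 ⊓ V2) - Module.finrank F ↥(C ⊓ rowSpaceIn (V1 ⊓ V2)) : ℤ)
      ≤ (m * Module.finrank F V1 - Module.finrank F ↥(C ⊓ rowSpaceIn V1) : ℤ)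
        + (m * Module.finrank F V2 - Module.finrank F ↥(C ⊓ rowSpaceIn V2) : ℤ)) := by
  refine ⟨fun V1 V2 h => ⟨?_, ?_⟩, fun V1 V2 => ?_⟩
  · have := rowSpaceIn.finrank_inf_add_le C h
    zify at this
    linarith
  · have := Submodule.finrank_mono (inf_le_inf_left C (rowSpaceIn.mono h))
    zify at this
    linarith
  · have hC := rowSpaceIn.finrank_inf_add_finrank_inf_le C V1 V2
    have hV := congrArg (m * ·) (Submodule.finrank_sup_add_finrank_inf_eq V1 V2)
    simp only [mul_add] at hV
    zify at hC hV
    linarith
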